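/- Let α ∈ ℝ and let {μₙ} and μ be finite signed Borel measures on ℝ. Suppose the sequence {μₙ} has no mass at any point of ℝ (i.e. for every x ∈ ℝ and every ε > 0 there exists an open neighbourhood N of x with limsup_{n→∞} |μₙ|(N) ≤ ε). Then the following are equivalent: (i) F_{μₙ}^{(α)}(x) → F_{μ}^{(α)}(x) at every continuity point x of μ; (ii) μₙ → μ vaguely. -/

import Mathlib

open MeasureTheory Filter Topology
open scoped ENNReal

/-- The distribution function of a finite positive Borel measure on ℝ, centred at α. -/
noncomputable def FcPos (μ : Measure ℝ) (α x : ℝ) : ℝ :=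
  if α ≤ x then (μ (Set.Ioc α x)).toReal else -(μ (Set.Ioc x α)).toReal

/-- The distribution function of a finite signed Borel measure on ℝ, centred at α. -/
noncomputable def Fc (μ : SignedMeasure ℝ) (α x : ℝ) : ℝ :=
  if α ≤ x then μ (Set.Ioc α x) else -μ (Set.Ioc x α)

/-- Integral of a real-valued function against a finite signed measure, via the
Hahn–Jordan decomposition `μ = μ⁺ - μ⁻`. -/
noncomputable def sInt {Ω : Type*} [MeasurableSpace Ω] (μ : SignedMeasure Ω) (f : Ω → ℝ) : ℝ :=
  (∫ x, f x ∂μ.toJordanDecomposition.posPart) - ∫ x, f x ∂μ.toJordanDecomposition.negPart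

/-- Vague convergence of signed measures on ℝ. -/
def VagueTendsto (μs : ℕ → SignedMeasure ℝ) (μ : SignedMeasure ℝ) : Prop :=
  ∀ f : ℝ → ℝ, Continuous f → HasCompactSupport f →
    Tendsto (fun n => sInt (μs n) f) atTop (𝓝 (sInt μ f))

/-- Vague convergence of positive measures on ℝ. -/
def VagueTendstoPos (μs : ℕ → Measure ℝ) (μ : Measure ℝ) : Prop :=
  ∀ f : ℝ → ℝ, Continuous f → HasCompactSupport f →
    Tendsto (fun n => ∫ x, f x ∂(μs n)) atTop (𝓝 (∫ x, f x ∂μ))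

/-- The sequence of signed measures has no mass at the point x. -/
def NoMassAt (μs : ℕ → SignedMeasure ℝ) (x : ℝ) : Prop :=
  ∀ ε : ℝ≥0∞, 0 < ε → ∃ N : Set ℝ, IsOpen N ∧ x ∈ N ∧
    limsup (fun n => (μs n).totalVariation N) atTop ≤ ε

namespace MeasureTheory.SignedMeasure

variable {Ω : Type*} [MeasurableSpace Ω]

instance isFiniteMeasure_totalVariation (μ : SignedMeasure Ω) :
    IsFiniteMeasure μ.totalVariation := by
  unfold totalVariation
  infer_instance

theorem sInt_sub (μ : SignedMeasure Ω) {f g : Ω → ℝ} (hf : Integrable f μ.totalVariation)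
    (hg : Integrable g μ.totalVariation) :
    sInt μ (fun x => f x - g x) = sInt μ f - sInt μ g := by
  have hf' := integrable_add_measure.1 hf
  have hg' := integrable_add_measure.1 hg
  simp only [sInt]
  rw [integral_sub hf'.1 hg'.1, integral_sub hf'.2 hg'.2]
  ring

theorem sInt_finsetSum (μ : SignedMeasure Ω) {ι : Type*} (s : Finset ι) {f : ι → Ω → ℝ}
    (hf : ∀ i, Integrable (f i) μ.totalVariation) :
    sInt μ (fun x => ∑ i ∈ s, f i x) = ∑ i ∈ s, sInt μ (f i) := by
  simp only [sInt]
  rw [integral_finsetSum _ fun i _ => (integrable_add_measure.1 (hf i)).1,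
    integral_finsetSum _ fun i _ => (integrable_add_measure.1 (hf i)).2,
    Finset.sum_sub_distrib]

theorem sInt_indicator_const (μ : SignedMeasure Ω) {s : Set Ω} (hs : MeasurableSet s) (c : ℝ) :
    sInt μ (s.indicator fun _ => c) = c * μ s := by
  rw [sInt, integral_indicator_const _ hs, integral_indicator_const _ hs,
    μ.apply_eq_posPart_real_sub_negPart_real hs]
  simp only [smul_eq_mul]
  ring

theorem abs_sInt_le (μ : SignedMeasure Ω) {f : Ω → ℝ} (hf : Integrable f μ.totalVariation) :
    |sInt μ f| ≤ ∫ x, |f x| ∂μ.totalVariation := by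
  have hf' := integrable_add_measure.1 hf
  rw [totalVariation, integral_add_measure hf'.1.abs hf'.2.abs, sInt]
  exact (abs_sub _ _).trans (add_le_add abs_integral_le_integral_abs abs_integral_le_integral_abs)

/-- If `f` and `g` differ by at most `C` on `s` and agree elsewhere, then their integrals against
`μ` differ by at most `C * |μ|(s)`. -/
theorem abs_sInt_sub_sInt_le (μ : SignedMeasure Ω) {f g : Ω → ℝ}
    (hf : Integrable f μ.totalVariation) (hg : Integrable g μ.totalVariation) {s : Set Ω}
    (hs : MeasurableSet s) {C : ℝ} (h : ∀ x, |f x - g x| ≤ s.indicator (fun _ => C) x) :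
    |sInt μ f - sInt μ g| ≤ C * μ.totalVariation.real s := by
  rw [← sInt_sub μ hf hg]
  refine (abs_sInt_le μ (hf.sub hg)).trans ?_
  refine (integral_mono (hf.sub hg).abs ((integrable_const C).indicator hs) h).trans_eq ?_
  rw [integral_indicator_const _ hs, smul_eq_mul, mul_comm]

theorem countable_setOf_apply_singleton_ne_zero (μ : SignedMeasure ℝ) :
    {x : ℝ | μ {x} ≠ 0}.Countable := by
  refine (Measure.countable_meas_pos_of_disjoint_iUnion (μ := μ.totalVariation)
    (As := fun x : ℝ => {x}) (fun x => measurableSet_singleton x) ?_).mono ?_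
  · intro x y hxy
    simpa [Function.onFun] using hxy
  · intro x hx
    exact pos_iff_ne_zero.2 fun h => hx (μ.null_of_totalVariation_zero h)

theorem apply_Ioc_eq_Fc_sub_Fc (μ : SignedMeasure ℝ) (α : ℝ) {a b : ℝ} (hab : a ≤ b) :
    μ (Set.Ioc a b) = Fc μ α b - Fc μ α a := by
  have key : ∀ {x y z : ℝ}, x ≤ y → y ≤ z →
      μ (Set.Ioc x z) = μ (Set.Ioc x y) + μ (Set.Ioc y z) := fun {x y z} hxy hyz => by
    rw [← Set.Ioc_union_Ioc_eq_Ioc hxy hyz]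
    exact VectorMeasure.of_union (Set.Ioc_disjoint_Ioc_of_le le_rfl) measurableSet_Ioc
      measurableSet_Ioc
  unfold Fc
  split_ifs with hb ha ha
  · linarith [key ha hab]
  · linarith [key (le_of_not_ge ha) hb]
  · exact absurd (ha.trans hab) hb
  · linarith [key hab (le_of_not_ge hb)]

end MeasureTheory.SignedMeasure

theorem NoMassAt.exists_ball {μs : ℕ → SignedMeasure ℝ} {x : ℝ} (h : NoMassAt μs x) {ε : ℝ}
    (hε : 0 < ε) :
    ∃ δ > 0, ∀ᶠ n in atTop, (μs n).totalVariation.real (Metric.ball x δ) ≤ ε := by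
  obtain ⟨N, hN, hxN, hlim⟩ := h (ENNReal.ofReal (ε / 2)) (by simpa using hε)
  obtain ⟨δ, hδ, hball⟩ := Metric.isOpen_iff.1 hN x hxN
  refine ⟨δ, hδ, ?_⟩
  have hlt : limsup (fun n => (μs n).totalVariation N) atTop < ENNReal.ofReal ε :=
    hlim.trans_lt ((ENNReal.ofReal_lt_ofReal_iff hε).2 (by linarith))
  filter_upwards [eventually_lt_of_limsup_lt hlt] with n hn
  exact ENNReal.toReal_le_of_le_ofReal hε.le ((measure_mono hball).trans hn.le)

theorem exists_eventually_totalVariation_le_of_isCompact {μs : ℕ → SignedMeasure ℝ}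
    (h : ∀ x, NoMassAt μs x) {K : Set ℝ} (hK : IsCompact K) :
    ∃ M : ℝ, ∀ᶠ n in atTop, (μs n).totalVariation.real K ≤ M := by
  refine hK.induction_on (p := fun K => ∃ M : ℝ, ∀ᶠ n in atTop,
    (μs n).totalVariation.real K ≤ M) ⟨0, by simp⟩ ?_ ?_ ?_
  · rintro s t hst ⟨M, hM⟩
    exact ⟨M, hM.mono fun n hn => (measureReal_mono hst).trans hn⟩
  · rintro s t ⟨M, hM⟩ ⟨M', hM'⟩
    refine ⟨M + M', ?_⟩
    filter_upwards [hM, hM'] with n hn hn'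
    exact (measureReal_union_le s t).trans (add_le_add hn hn')
  · intro x _
    obtain ⟨δ, hδ, hM⟩ := (h x).exists_ball one_pos
    exact ⟨_, mem_nhdsWithin_of_mem_nhds (Metric.ball_mem_nhds x hδ), 1, hM⟩

theorem Monotone.sum_indicator_Ioc {t : ℕ → ℝ} (ht : Monotone t) (f : ℝ → ℝ) (m : ℕ) (x : ℝ) :
    ∑ i ∈ Finset.range m, (Set.Ioc (t i) (t (i + 1))).indicator f x =
      (Set.Ioc (t 0) (t m)).indicator f x := by
  induction m with
  | zero => simp
  | succ m ih =>
    rw [Finset.sum_range_succ, ih,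
      ← Set.Ioc_union_Ioc_eq_Ioc (ht (Nat.zero_le m)) (ht m.le_succ),
      Set.indicator_union_of_disjoint (Set.Ioc_disjoint_Ioc_of_le le_rfl)]

/-- A continuous function supported in `[-R, R]` is uniformly within `ε` of a step function
supported in `[-R - 1, R + 1]` whose steps avoid a given countable set. -/
theorem Continuous.exists_step_approx {f : ℝ → ℝ} (hf : Continuous f)
    (hcs : HasCompactSupport f) {R : ℝ} (hR : ∀ x, R < |x| → f x = 0) {B : Set ℝ}
    (hB : B.Countable) {ε : ℝ} (hε : 0 < ε) :
    ∃ (t : ℕ → ℝ) (m : ℕ), Monotone t ∧ (∀ i, t i ∉ B) ∧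
      ∀ x, |f x - ∑ i ∈ Finset.range m,
        (Set.Ioc (t i) (t (i + 1))).indicator (fun _ => f (t (i + 1))) x| ≤
          (Metric.closedBall 0 (R + 1)).indicator (fun _ => ε) x := by
  obtain ⟨δ, hδ, hunif⟩ := Metric.uniformContinuous_iff.1
    (hcs.uniformContinuous_of_continuous hf) ε hε
  obtain ⟨d, hd, hdδ, hd1⟩ : ∃ d : ℝ, 0 < d ∧ d < δ ∧ d < 1 :=
    ⟨min δ 1 / 2, by positivity, by linarith [min_le_left δ 1, lt_min hδ one_pos],
      by linarith [min_le_right δ 1]⟩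
  have hcount : (⋃ i : ℕ, (fun c : ℝ => c + i * d) ⁻¹' B).Countable :=
    Set.countable_iUnion fun i => hB.preimage (add_left_injective _)
  obtain ⟨c, hc, hcR⟩ := (hcount.dense_compl ℝ).exists_lt (-R)
  obtain ⟨m, hm⟩ := exists_nat_gt ((R - c) / d)
  rw [div_lt_iff₀ hd] at hm
  have ht : Monotone fun i : ℕ => c + i * d := fun i j hij => by
    have : (i : ℝ) ≤ j := by exact_mod_cast hij
    dsimp only
    gcongr
  refine ⟨fun i => c + i * d, m, ht, fun i hi => hc (Set.mem_iUnion.2 ⟨i, hi⟩), fun x => ?_⟩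
  have hfx : f x = (Set.Ioc (c + (0 : ℕ) * d) (c + m * d)).indicator f x := by
    by_cases hx : x ∈ Set.Ioc (c + (0 : ℕ) * d) (c + m * d)
    · rw [Set.indicator_of_mem hx]
    · rw [Set.indicator_of_notMem hx]
      refine hR x ?_
      simp only [Set.mem_Ioc, not_and_or, not_lt, not_le, Nat.cast_zero, zero_mul, add_zero] at hx
      rcases hx with hx | hx
      · exact lt_abs.2 (Or.inr (by linarith))
      · exact lt_abs.2 (Or.inl (by linarith))
  have hdist : ∀ i : ℕ, x ∈ Set.Ioc (c + i * d) (c + (i + 1 : ℕ) * d) →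
      |x - (c + (i + 1 : ℕ) * d)| ≤ d := fun i hx => by
    obtain ⟨h1, h2⟩ := hx
    rw [abs_le]
    push_cast at h2 ⊢
    constructor <;> linarith
  by_cases hxR : |x| ≤ R + 1
  · rw [Set.indicator_of_mem (show x ∈ Metric.closedBall 0 (R + 1) by simpa using hxR)]
    refine le_trans ?_ (Set.indicator_le_self' (s := Set.Ioc (c + (0 : ℕ) * d) (c + m * d))
      (f := fun _ => ε) (fun _ _ => hε.le) x)
    rw [hfx, ← ht.sum_indicator_Ioc f, ← ht.sum_indicator_Ioc (fun _ => ε),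
      ← Finset.sum_sub_distrib]
    refine (Finset.abs_sum_le_sum_abs _ _).trans (Finset.sum_le_sum fun i _ => ?_)
    dsimp only
    by_cases hx : x ∈ Set.Ioc (c + i * d) (c + (i + 1 : ℕ) * d)
    · simp only [Set.indicator_of_mem hx]
      exact (hunif ((hdist i hx).trans_lt hdδ)).le
    · simp only [Set.indicator_of_notMem hx, sub_self, abs_zero, le_refl]
  · rw [Set.indicator_of_notMem (by simpa using hxR), hR x (by linarith),
      Finset.sum_eq_zero, sub_self, abs_zero]
    intro i _
    by_cases hx : x ∈ Set.Ioc (c + i * d) (c + (i + 1 : ℕ) * d)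
    · rw [Set.indicator_of_mem hx]
      refine hR _ ?_
      linarith [hdist i hx, abs_sub_abs_le_abs_sub x (c + (i + 1 : ℕ) * d)]
    · exact Set.indicator_of_notMem hx _

/-- A continuous, piecewise linear approximation from outside of the indicator of `Ioc a b`. -/
noncomputable def trapezoid (a b δ t : ℝ) : ℝ :=
  max 0 (min 1 (min ((t - a) / δ) (1 - (t - b) / δ)))

namespace trapezoid

theorem continuous (a b δ : ℝ) : Continuous (trapezoid a b δ) := by
  unfold trapezoid
  fun_prop

theorem nonneg (a b δ t : ℝ) : 0 ≤ trapezoid a b δ t := le_max_left _ _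

theorem le_one (a b δ t : ℝ) : trapezoid a b δ t ≤ 1 :=
  max_le zero_le_one (min_le_left _ _)

variable {a b δ t : ℝ}

theorem eq_zero_of_le (hδ : 0 < δ) (h : t ≤ a) : trapezoid a b δ t = 0 :=
  max_eq_left <| (min_le_right _ _).trans <| (min_le_left _ _).trans <|
    div_nonpos_of_nonpos_of_nonneg (sub_nonpos.2 h) hδ.le

theorem eq_zero_of_add_le (hδ : 0 < δ) (h : b + δ ≤ t) : trapezoid a b δ t = 0 :=
  max_eq_left <| (min_le_right _ _).trans <| (min_le_right _ _).trans <|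
    sub_nonpos.2 <| (one_le_div hδ).2 (by linarith)

theorem eq_one (hδ : 0 < δ) (ha : a + δ ≤ t) (hb : t ≤ b) : trapezoid a b δ t = 1 := by
  have h1 : 1 ≤ (t - a) / δ := (one_le_div hδ).2 (by linarith)
  have h2 : (t - b) / δ ≤ 0 := div_nonpos_of_nonpos_of_nonneg (sub_nonpos.2 hb) hδ.le
  rw [trapezoid, min_eq_left (le_min h1 (by linarith)), max_eq_right zero_le_one]

theorem hasCompactSupport (hδ : 0 < δ) : HasCompactSupport (trapezoid a b δ) := by
  refine HasCompactSupport.intro (isCompact_Icc (a := a) (b := b + δ)) fun t ht => ?_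
  rcases not_and_or.1 ht with h | h
  · exact eq_zero_of_le hδ (le_of_not_ge h)
  · exact eq_zero_of_add_le hδ (le_of_not_ge h)

theorem eq_indicator (hδ : 0 < δ) (ha : t ≤ a ∨ a + δ ≤ t) (hb : t ≤ b ∨ b + δ ≤ t) :
    trapezoid a b δ t = (Set.Ioc a b).indicator (fun _ => 1) t := by
  rcases ha with ha | ha
  · rw [eq_zero_of_le hδ ha, Set.indicator_of_notMem fun h : t ∈ Set.Ioc a b => h.1.not_ge ha]
  rcases hb with hb | hb
  · rw [eq_one hδ ha hb, Set.indicator_of_mem (show t ∈ Set.Ioc a b from ⟨by linarith, hb⟩)]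
  · rw [eq_zero_of_add_le hδ hb, Set.indicator_of_notMem fun h : t ∈ Set.Ioc a b => by linarith [h.2]]

theorem integrable (a b δ : ℝ) (ν : Measure ℝ) [IsFiniteMeasure ν] :
    Integrable (trapezoid a b δ) ν :=
  Integrable.of_bound (continuous a b δ).aestronglyMeasurable 1 <| .of_forall fun t => by
    rw [Real.norm_of_nonneg (nonneg a b δ t)]
    exact le_one a b δ t

theorem tendsto_indicator (a b t : ℝ) :
    Tendsto (fun δ => trapezoid a b δ t) (𝓝[>] 0)
      (𝓝 ((Set.Ioc a b).indicator (fun _ => 1) t)) := by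
  have aux : ∀ c : ℝ, ∀ᶠ δ in 𝓝[>] (0 : ℝ), t ≤ c ∨ c + δ ≤ t := fun c => by
    rcases le_or_gt t c with h | h
    · exact .of_forall fun _ => Or.inl h
    · filter_upwards [nhdsWithin_le_nhds (Iio_mem_nhds (sub_pos.2 h))] with δ hδ
      exact Or.inr (by linarith [show δ < t - c from hδ])
  refine tendsto_const_nhds.congr' ?_
  filter_upwards [self_mem_nhdsWithin, aux a, aux b] with δ hδ ha hb
  exact (eq_indicator hδ ha hb).symm

theorem tendsto_integral (a b : ℝ) (ν : Measure ℝ) [IsFiniteMeasure ν] :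
    Tendsto (fun δ => ∫ t, trapezoid a b δ t ∂ν) (𝓝[>] 0)
      (𝓝 (∫ t, (Set.Ioc a b).indicator (fun _ => (1 : ℝ)) t ∂ν)) := by
  refine tendsto_integral_filter_of_dominated_convergence (fun _ => 1)
    (.of_forall fun δ => (continuous a b δ).aestronglyMeasurable)
    (.of_forall fun δ => .of_forall fun t => ?_) (integrable_const _)
    (.of_forall fun t => tendsto_indicator a b t)
  rw [Real.norm_of_nonneg (nonneg a b δ t)]
  exact le_one a b δ t

theorem tendsto_sInt (a b : ℝ) (μ : SignedMeasure ℝ) :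
    Tendsto (fun δ => sInt μ (trapezoid a b δ)) (𝓝[>] 0) (𝓝 (μ (Set.Ioc a b))) := by
  have h := (tendsto_integral a b μ.toJordanDecomposition.posPart).sub
    (tendsto_integral a b μ.toJordanDecomposition.negPart)
  have h' := μ.sInt_indicator_const (measurableSet_Ioc (a := a) (b := b)) 1
  rw [one_mul] at h'
  rw [← h']
  exact h

end trapezoid

theorem VagueTendsto.tendsto_apply_Ioc {μs : ℕ → SignedMeasure ℝ} {μ : SignedMeasure ℝ}
    (h : VagueTendsto μs μ) {a b : ℝ} (ha : NoMassAt μs a) (hb : NoMassAt μs b) :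
    Tendsto (fun n => μs n (Set.Ioc a b)) atTop (𝓝 (μ (Set.Ioc a b))) := by
  rw [Metric.tendsto_nhds]
  intro ε hε
  have hε4 : 0 < ε / 4 := by positivity
  obtain ⟨r, hr, hra⟩ := ha.exists_ball hε4
  obtain ⟨s, hs, hsb⟩ := hb.exists_ball hε4
  obtain ⟨δ, ⟨⟨hδ, hδr⟩, hδs⟩, hμ⟩ := (((eventually_mem_nhdsWithin (a := (0 : ℝ))
    (s := Set.Ioi 0)).and (nhdsWithin_le_nhds (eventually_lt_nhds hr))).and
      (nhdsWithin_le_nhds (eventually_lt_nhds hs))).and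
        (Metric.tendsto_nhds.1 (trapezoid.tendsto_sInt a b μ) _ hε4) |>.exists
  replace hδ : 0 < δ := hδ
  filter_upwards [hra, hsb, Metric.tendsto_nhds.1
    (h _ (trapezoid.continuous a b δ) (trapezoid.hasCompactSupport hδ)) _ hε4] with n hna hnb hn
  have hS : MeasurableSet (Metric.ball a r ∪ Metric.ball b s) :=
    measurableSet_ball.union measurableSet_ball
  have hdiff := (μs n).abs_sInt_sub_sInt_le (trapezoid.integrable a b δ _)
    ((integrable_const (1 : ℝ)).indicator (measurableSet_Ioc (a := a) (b := b))) hS (C := 1) ?_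
  · rw [(μs n).sInt_indicator_const measurableSet_Ioc, one_mul, one_mul] at hdiff
    have hU := measureReal_union_le (μ := (μs n).totalVariation) (Metric.ball a r)
      (Metric.ball b s)
    rw [Real.dist_eq, abs_lt] at *
    rw [abs_le] at hdiff
    constructor <;> linarith
  · intro t
    by_cases ht : t ∈ Metric.ball a r ∪ Metric.ball b s
    · rw [Set.indicator_of_mem ht, abs_le]
      have h0 := trapezoid.nonneg a b δ t
      have h1 := trapezoid.le_one a b δ t
      by_cases hI : t ∈ Set.Ioc a b
      · rw [Set.indicator_of_mem hI]; constructor <;> linarith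
      · rw [Set.indicator_of_notMem hI]; constructor <;> linarith
    · rw [Set.indicator_of_notMem ht]
      simp only [Set.mem_union, Metric.mem_ball, Real.dist_eq, not_or, not_lt, le_abs] at ht
      rw [trapezoid.eq_indicator hδ, sub_self, abs_zero]
      · rcases ht.1 with h | h
        · exact Or.inr (by linarith)
        · exact Or.inl (by linarith)
      · rcases ht.2 with h | h
        · exact Or.inr (by linarith)
        · exact Or.inl (by linarith)

theorem vagueTendsto_of_tendsto_apply_Ioc {μs : ℕ → SignedMeasure ℝ} {μ : SignedMeasure ℝ}
    (hnomass : ∀ x, NoMassAt μs x)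
    (h : ∀ a b : ℝ, a ≤ b → μ {a} = 0 → μ {b} = 0 →
      Tendsto (fun n => μs n (Set.Ioc a b)) atTop (𝓝 (μ (Set.Ioc a b)))) :
    VagueTendsto μs μ := by
  intro f hf hcs
  obtain ⟨R, hR⟩ := hcs.isCompact.isBounded.subset_closedBall 0
  have hzero : ∀ x, R < |x| → f x = 0 := fun x hx => by
    by_contra hne
    have := hR (subset_tsupport f hne)
    simp only [Metric.mem_closedBall, dist_zero_right, Real.norm_eq_abs] at this
    linarith
  obtain ⟨M, hM⟩ := exists_eventually_totalVariation_le_of_isCompact hnomass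
    (isCompact_closedBall (0 : ℝ) (R + 1))
  set M' := max M (μ.totalVariation.real (Metric.closedBall 0 (R + 1)))
  have hM'0 : 0 ≤ M' := measureReal_nonneg.trans (le_max_right _ _)
  rw [Metric.tendsto_nhds]
  intro ε hε
  have hη : 0 < ε / (3 * (M' + 1)) := by positivity
  have hηM : ε / (3 * (M' + 1)) * M' < ε / 3 := by
    rw [div_mul_eq_mul_div, div_lt_div_iff₀ (by positivity) (by positivity)]
    nlinarith
  obtain ⟨t, m, ht, htB, happrox⟩ := hf.exists_step_approx hcs hzero
    μ.countable_setOf_apply_singleton_ne_zero hη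
  have ht0 : ∀ i, μ {t i} = 0 := fun i => not_not.1 (htB i)
  have hstep : ∀ ν : SignedMeasure ℝ,
      ν.totalVariation.real (Metric.closedBall 0 (R + 1)) ≤ M' →
      |sInt ν f - ∑ i ∈ Finset.range m, f (t (i + 1)) * ν (Set.Ioc (t i) (t (i + 1)))| <
        ε / 3 := fun ν hν => by
    have hint : ∀ i, Integrable ((Set.Ioc (t i) (t (i + 1))).indicator
        fun _ => f (t (i + 1))) ν.totalVariation := fun i =>
      (integrable_const _).indicator measurableSet_Ioc
    have := ν.abs_sInt_sub_sInt_le (hf.integrable_of_hasCompactSupport hcs)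
      (integrable_finsetSum (Finset.range m) fun i _ => hint i)
      Metric.isClosed_closedBall.measurableSet happrox
    rw [ν.sInt_finsetSum _ hint] at this
    simp only [ν.sInt_indicator_const measurableSet_Ioc] at this
    exact this.trans_lt ((mul_le_mul_of_nonneg_left hν hη.le).trans_lt hηM)
  have hsum := tendsto_finsetSum (Finset.range m) fun i _ =>
    (h _ _ (ht i.le_succ) (ht0 i) (ht0 (i + 1))).const_mul (f (t (i + 1)))
  have hμ := hstep μ (le_max_right _ _)
  filter_upwards [hM, Metric.tendsto_nhds.1 hsum (ε / 3) (by positivity)] with n hMn hn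
  have hμn := hstep (μs n) (hMn.trans (le_max_left _ _))
  rw [Real.dist_eq, abs_lt] at hn ⊢
  rw [abs_lt] at hμ hμn
  constructor <;> linarith [hn.1, hn.2, hμ.1, hμ.2, hμn.1, hμn.2]

theorem stmt14 (α : ℝ) (μs : ℕ → SignedMeasure ℝ) (μ : SignedMeasure ℝ)
    (hnomass : ∀ x : ℝ, NoMassAt μs x) :
    (∀ x : ℝ, μ {x} = (0 : ℝ) →
        Tendsto (fun n => Fc (μs n) α x) atTop (𝓝 (Fc μ α x)))
      ↔ VagueTendsto μs μ := by
  constructor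
  · intro h
    refine vagueTendsto_of_tendsto_apply_Ioc hnomass fun a b hab ha hb => ?_
    simp only [SignedMeasure.apply_Ioc_eq_Fc_sub_Fc _ α hab]
    exact (h b hb).sub (h a ha)
  · intro h x _
    unfold Fc
    split_ifs
    · exact h.tendsto_apply_Ioc (hnomass α) (hnomass x)
    · exact (h.tendsto_apply_Ioc (hnomass x) (hnomass α)).neg
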